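/- Let s > 1/2 and let B ∈ ℝ^{d×d} be a symmetric matrix, and set g(x) = e^{i⟨Bx,x⟩/2}. If f ∈ Σ_s(ℝ^d) then g·f ∈ Σ_s(ℝ^d); moreover, for every A > 0 there exist A' > 0 and C > 0 such that |g·f|_A ≤ C |f|_{A'} for all f ∈ Σ_s(ℝ^d), where |f|_A := sup { A^{|β|} e^{A|x|^{1/s}} |∂^β f(x)| / (β!)^s : x ∈ ℝ^d, β ∈ ℕ^d }. In particular, multiplication by g is a continuous map from Σ_s(ℝ^d) to itself. -/

import Mathlib

open MeasureTheory Filter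
open scoped BigOperators ENNReal RealInnerProductSpace

noncomputable section

/-- `ℝ^d` with the Euclidean norm. -/
abbrev Ed (d : ℕ) : Type := EuclideanSpace ℝ (Fin d)

/-- Partial derivative along the `i`-th coordinate direction. -/
def pdGS {d : ℕ} (i : Fin d) (f : Ed d → ℂ) : Ed d → ℂ :=
  fun x => fderiv ℝ f x (EuclideanSpace.single i 1)

/-- Multi-index partial derivative `∂^β`. -/
def mderiv {d : ℕ} (β : Fin d → ℕ) (f : Ed d → ℂ) : Ed d → ℂ :=
  ((List.ofFn fun i : Fin d => (pdGS i)^[β i]).foldr (· ∘ ·) id) f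

/-- Monomial `x^α`. -/
def mpow {d : ℕ} (x : Ed d) (α : Fin d → ℕ) : ℝ := ∏ i, x i ^ α i

/-- Multi-index factorial `α!`. -/
def mfact {d : ℕ} (α : Fin d → ℕ) : ℕ := ∏ i, Nat.factorial (α i)

/-- Multi-index length `|α|`. -/
def mlen {d : ℕ} (α : Fin d → ℕ) : ℕ := ∑ i, α i

/-- The Gelfand–Shilov seminorm `‖f‖_{S_{s,h}}`, valued in `[0,∞]`. -/
def GSnorm {d : ℕ} (s h : ℝ) (f : Ed d → ℂ) : ℝ≥0∞ :=
  ⨆ (x : Ed d) (α : Fin d → ℕ) (β : Fin d → ℕ),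
    ENNReal.ofReal (|mpow x α| * ‖mderiv β f x‖ /
      (h ^ (mlen α + mlen β) * ((mfact α : ℝ) * (mfact β : ℝ)) ^ s))

/-- The Gelfand–Shilov space `Σ_s(ℝ^d)`: smooth functions all of whose
`S_{s,h}` seminorms are finite. -/
def SigmaGS (s : ℝ) (d : ℕ) : Set (Ed d → ℂ) :=
  {f | ContDiff ℝ ((⊤ : ℕ∞) : WithTop ℕ∞) f ∧ ∀ h : ℝ, 0 < h → GSnorm s h f < ⊤}

/-- The seminorm `|f|_A`, valued in `[0,∞]`. -/
def GSnormA {d : ℕ} (s A : ℝ) (f : Ed d → ℂ) : ℝ≥0∞ :=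
  ⨆ (x : Ed d) (β : Fin d → ℕ),
    ENNReal.ofReal (A ^ mlen β * Real.exp (A * ‖x‖ ^ (1/s)) * ‖mderiv β f x‖ /
      (mfact β : ℝ) ^ s)

/-- The Fourier transform `f̂(ξ) = ∫ f(x) e^{-i⟨x,ξ⟩} dx`. -/
def FTgs {d : ℕ} (f : Ed d → ℂ) (ξ : Ed d) : ℂ :=
  ∫ x : Ed d, f x * Complex.exp (-(Complex.I * (⟪x, ξ⟫ : ℝ)))

/-- The short-time Fourier transform of a function `f` with window `φ`. -/
def STFTgs {d : ℕ} (φ f : Ed d → ℂ) (z : Ed d × Ed d) : ℂ :=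
  ∫ y : Ed d, f y * (starRingEnd ℂ) (φ (y - z.1)) * Complex.exp (-(Complex.I * (⟪y, z.2⟫ : ℝ)))

/-- Euclidean norm of a phase-space point `(x,ξ) ∈ ℝ^{2d}`. -/
def pnorm {d : ℕ} (z : Ed d × Ed d) : ℝ := Real.sqrt (‖z.1‖ ^ 2 + ‖z.2‖ ^ 2)

/-- A conic subset: invariant under multiplication by positive reals. -/
def IsConic {V : Type*} [SMul ℝ V] (Γ : Set V) : Prop :=
  ∀ t : ℝ, 0 < t → ∀ z ∈ Γ, t • z ∈ Γ

/-- Tempered distributions on `ℝ^d`. -/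
abbrev TD (d : ℕ) : Type := SchwartzMap (Ed d) ℂ →L[ℂ] ℂ

/-- `W` is the short-time Fourier transform `V_φ u` of the tempered distribution `u`
with respect to the window `φ`. -/
def IsSTFT {d : ℕ} (u : TD d) (φ : Ed d → ℂ) (W : Ed d × Ed d → ℂ) : Prop :=
  ∀ (x ξ : Ed d) (g : SchwartzMap (Ed d) ℂ),
    (∀ y : Ed d, g y = (starRingEnd ℂ) (φ (y - x)) * Complex.exp (-(Complex.I * (⟪y, ξ⟫ : ℝ)))) →
    W (x, ξ) = u g

/-- The `s`-Gelfand–Shilov wave front set of a distribution whose short-time Fourier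
transform is `W`: the set of nonzero phase-space points having no open conic
neighbourhood on which `e^{A|z|^{1/s}} |W(z)|` is bounded for every `A > 0`. -/
def WFs {d : ℕ} (s : ℝ) (W : Ed d × Ed d → ℂ) : Set (Ed d × Ed d) :=
  {z₀ | z₀ ≠ 0 ∧ ¬ ∃ Γ : Set (Ed d × Ed d), IsOpen Γ ∧ IsConic Γ ∧
    (0 : Ed d × Ed d) ∉ Γ ∧ z₀ ∈ Γ ∧
    ∀ A : ℝ, 0 < A → ∃ C : ℝ, ∀ z ∈ Γ, Real.exp (A * pnorm z ^ (1/s)) * ‖W z‖ ≤ C}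

/-- The real quadratic form `⟨Bx, x⟩` of a matrix `B`. -/
def qf {d : ℕ} (B : Matrix (Fin d) (Fin d) ℝ) (x : Ed d) : ℝ :=
  ∑ i, (∑ j, B i j * x j) * x i

/-- Tempered distributions on `ℝ^m × ℝ^n`. -/
abbrev TD2 (m n : ℕ) : Type := SchwartzMap (Ed m × Ed n) ℂ →L[ℂ] ℂ

/-- Short-time Fourier transform of a tempered distribution on `ℝ^m × ℝ^n`. -/
def IsSTFT2 {m n : ℕ} (w : TD2 m n) (Φ : Ed m × Ed n → ℂ)
    (W : (Ed m × Ed n) × (Ed m × Ed n) → ℂ) : Prop :=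
  ∀ (x ξ : Ed m × Ed n) (g : SchwartzMap (Ed m × Ed n) ℂ),
    (∀ y : Ed m × Ed n, g y = (starRingEnd ℂ) (Φ (y - x)) *
      Complex.exp (-(Complex.I * ((⟪y.1, ξ.1⟫ + ⟪y.2, ξ.2⟫ : ℝ))))) →
    W (x, ξ) = w g

/-- Euclidean norm of a phase-space point of `T^*(ℝ^m × ℝ^n)`. -/
def pnorm2 {m n : ℕ} (z : (Ed m × Ed n) × (Ed m × Ed n)) : ℝ :=
  Real.sqrt (‖z.1.1‖ ^ 2 + ‖z.1.2‖ ^ 2 + ‖z.2.1‖ ^ 2 + ‖z.2.2‖ ^ 2)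

/-- The `s`-Gelfand–Shilov wave front set on `ℝ^m × ℝ^n`. -/
def WFs2 {m n : ℕ} (s : ℝ) (W : (Ed m × Ed n) × (Ed m × Ed n) → ℂ) :
    Set ((Ed m × Ed n) × (Ed m × Ed n)) :=
  {z₀ | z₀ ≠ 0 ∧ ¬ ∃ Γ : Set ((Ed m × Ed n) × (Ed m × Ed n)), IsOpen Γ ∧ IsConic Γ ∧
    (0 : (Ed m × Ed n) × (Ed m × Ed n)) ∉ Γ ∧ z₀ ∈ Γ ∧
    ∀ A : ℝ, 0 < A → ∃ C : ℝ, ∀ z ∈ Γ, Real.exp (A * pnorm2 z ^ (1/s)) * ‖W z‖ ≤ C}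

/-- Iterated partial derivatives along a word of coordinate indices; the head of the word is
differentiated first. -/
def wordDeriv {d : ℕ} : List (Fin d) → (Ed d → ℂ) → Ed d → ℂ
  | [], f => f
  | i :: L, f => wordDeriv L (pdGS i f)

theorem ContDiff.pdGS {d : ℕ} {f : Ed d → ℂ} (hf : ContDiff ℝ ((⊤ : ℕ∞) : WithTop ℕ∞) f)
    (i : Fin d) : ContDiff ℝ ((⊤ : ℕ∞) : WithTop ℕ∞) (pdGS i f) :=
  (hf.fderiv_right (by simp)).clm_apply contDiff_const

theorem pdGS_comm {d : ℕ} {f : Ed d → ℂ} (hf : ContDiff ℝ ((⊤ : ℕ∞) : WithTop ℕ∞) f)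
    (i j : Fin d) : pdGS i (pdGS j f) = pdGS j (pdGS i f) := by
  have hd : ContDiff ℝ ((⊤ : ℕ∞) : WithTop ℕ∞) (fderiv ℝ f) := hf.fderiv_right (by simp)
  have key : ∀ v w : Ed d, ∀ x, fderiv ℝ (fun y => fderiv ℝ f y v) x w
      = fderiv ℝ (fderiv ℝ f) x w v := by
    intro v w x
    rw [fderiv_clm_apply ((hd.differentiable (by simp)) x) (by fun_prop)]
    simp
  funext x
  have hs : IsSymmSndFDerivAt ℝ f x :=
    hf.contDiffAt.isSymmSndFDerivAt (by
      simpa [minSmoothness_of_isRCLikeNormedField] using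
        WithTop.coe_le_coe.2 (le_top : (2 : ℕ∞) ≤ ⊤))
  unfold _root_.pdGS
  rw [key, key]
  exact hs _ _

theorem pdGS_add {d : ℕ} {f g : Ed d → ℂ} (hf : ContDiff ℝ ((⊤ : ℕ∞) : WithTop ℕ∞) f)
    (hg : ContDiff ℝ ((⊤ : ℕ∞) : WithTop ℕ∞) g) (i : Fin d) :
    pdGS i (f + g) = pdGS i f + pdGS i g := by
  funext x
  simp only [pdGS, Pi.add_apply]
  rw [fderiv_add ((hf.differentiable (by simp)) x) ((hg.differentiable (by simp)) x)]
  rfl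

theorem pdGS_mul {d : ℕ} {f g : Ed d → ℂ} (hf : ContDiff ℝ ((⊤ : ℕ∞) : WithTop ℕ∞) f)
    (hg : ContDiff ℝ ((⊤ : ℕ∞) : WithTop ℕ∞) g) (i : Fin d) :
    pdGS i (f * g) = pdGS i f * g + f * pdGS i g := by
  funext x
  simp only [pdGS, Pi.add_apply, Pi.mul_apply]
  rw [fderiv_mul ((hf.differentiable (by simp)) x) ((hg.differentiable (by simp)) x)]
  simp
  ring

theorem wordDeriv_add {d : ℕ} (L : List (Fin d)) {f g : Ed d → ℂ}
    (hf : ContDiff ℝ ((⊤ : ℕ∞) : WithTop ℕ∞) f) (hg : ContDiff ℝ ((⊤ : ℕ∞) : WithTop ℕ∞) g) :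
    wordDeriv L (f + g) = wordDeriv L f + wordDeriv L g := by
  induction L generalizing f g with
  | nil => rfl
  | cons i L ih => simp only [wordDeriv, pdGS_add hf hg]; exact ih (hf.pdGS i) (hg.pdGS i)

theorem wordDeriv_const_mul {d : ℕ} (L : List (Fin d)) {f : Ed d → ℂ} (c : ℂ)
    (hf : ContDiff ℝ ((⊤ : ℕ∞) : WithTop ℕ∞) f) :
    wordDeriv L ((fun _ => c) * f) = (fun _ => c) * wordDeriv L f := by
  induction L generalizing f with
  | nil => rfl
  | cons i L ih =>
    have h0 : pdGS i (fun _ : Ed d => c) = 0 := by funext x; simp [pdGS]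
    simp only [wordDeriv, pdGS_mul contDiff_const hf, h0, zero_mul, zero_add]
    exact ih (hf.pdGS i)

theorem wordDeriv_append {d : ℕ} (L L' : List (Fin d)) (f : Ed d → ℂ) :
    wordDeriv (L ++ L') f = wordDeriv L' (wordDeriv L f) := by
  induction L generalizing f with
  | nil => rfl
  | cons i L ih => exact ih _

theorem wordDeriv_replicate {d : ℕ} (n : ℕ) (i : Fin d) (f : Ed d → ℂ) :
    wordDeriv (List.replicate n i) f = (pdGS i)^[n] f := by
  induction n generalizing f with
  | zero => rfl
  | succ n ih => rw [List.replicate_succ, Function.iterate_succ_apply]; exact ih _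

theorem wordDeriv_perm {d : ℕ} {L L' : List (Fin d)} (h : L.Perm L') {f : Ed d → ℂ}
    (hf : ContDiff ℝ ((⊤ : ℕ∞) : WithTop ℕ∞) f) : wordDeriv L f = wordDeriv L' f := by
  induction h generalizing f with
  | nil => rfl
  | cons i _ ih => exact ih (hf.pdGS i)
  | swap i j L => simp only [wordDeriv, pdGS_comm hf]
  | trans _ _ ih₁ ih₂ => exact (ih₁ hf).trans (ih₂ hf)

/-- The word in which the index `i` occurs `β i` times. -/
def wordOf {d : ℕ} (β : Fin d → ℕ) : List (Fin d) :=
  ((List.finRange d).reverse.map fun i => List.replicate (β i) i).flatten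

theorem mderiv_eq_wordDeriv {d : ℕ} (β : Fin d → ℕ) (f : Ed d → ℂ) :
    mderiv β f = wordDeriv (wordOf β) f := by
  have key : ∀ Q : List (Fin d), ((Q.map fun i => (pdGS i)^[β i]).foldr (· ∘ ·) id) f
      = wordDeriv (Q.reverse.map fun i => List.replicate (β i) i).flatten f := by
    intro Q
    induction Q with
    | nil => rfl
    | cons i Q ih =>
      simp only [List.map_cons, List.foldr_cons, List.reverse_cons, List.map_append,
        List.map_nil, List.flatten_append, wordDeriv_append, Function.comp_apply, ih]
      simp [wordDeriv_replicate]
  rw [mderiv, List.ofFn_eq_map]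
  exact key _

theorem count_wordOf {d : ℕ} (β : Fin d → ℕ) (i : Fin d) : (wordOf β).count i = β i := by
  rw [wordOf, List.count_flatten, List.map_map, List.map_reverse, List.sum_reverse,
    ← List.ofFn_eq_map, List.sum_ofFn]
  simp [List.count_replicate]

theorem length_wordOf {d : ℕ} (β : Fin d → ℕ) : (wordOf β).length = mlen β := by
  rw [wordOf, List.length_flatten, List.map_map, List.map_reverse, List.sum_reverse,
    ← List.ofFn_eq_map, List.sum_ofFn]
  simp [mlen]

/-- Every word derivative of a smooth function is a multi-index derivative of the same order. -/
theorem exists_mderiv_eq_wordDeriv {d : ℕ} (L : List (Fin d)) :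
    ∃ β : Fin d → ℕ, mlen β = L.length ∧ ∀ f : Ed d → ℂ,
      ContDiff ℝ ((⊤ : ℕ∞) : WithTop ℕ∞) f → wordDeriv L f = mderiv β f := by
  have hp : (wordOf fun i => L.count i).Perm L :=
    List.perm_iff_count.2 fun i => count_wordOf _ i
  refine ⟨fun i => L.count i, ?_, fun f hf => ?_⟩
  · rw [← length_wordOf, hp.length_eq]
  · rw [mderiv_eq_wordDeriv, wordDeriv_perm hp hf]

theorem mfact_pos {d : ℕ} (β : Fin d → ℕ) : 0 < mfact β :=
  Finset.prod_pos fun i _ => (β i).factorial_pos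

theorem mfact_le_factorial_mlen {d : ℕ} (β : Fin d → ℕ) : mfact β ≤ (mlen β).factorial :=
  Nat.le_of_dvd (Nat.factorial_pos _) (Nat.prod_factorial_dvd_factorial_sum _ _)

theorem factorial_mlen_le {d : ℕ} (β : Fin d → ℕ) :
    (mlen β).factorial ≤ d ^ mlen β * mfact β := by
  have h1 := Finset.sum_pow_eq_sum_piAntidiag (Finset.univ : Finset (Fin d)) (fun _ => (1 : ℕ))
    (mlen β)
  have h2 : Nat.multinomial Finset.univ β ≤ d ^ mlen β := by
    simp only [one_pow, Finset.prod_const_one, mul_one, Finset.sum_const, Finset.card_univ,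
      Fintype.card_fin, smul_eq_mul, Nat.cast_id] at h1
    rw [h1]
    exact Finset.single_le_sum (f := fun k => Nat.multinomial Finset.univ k)
      (fun _ _ => Nat.zero_le _) (by simp [Finset.mem_piAntidiag, mlen])
  have h3 := Nat.multinomial_spec (Finset.univ : Finset (Fin d)) β
  rw [mlen, ← h3, mul_comm]
  exact Nat.mul_le_mul_right _ h2

/-- Truncation of the series `∑ b ^ k / (k!) ^ s`. -/
def truncGS (s b : ℝ) (n : ℕ) : ℝ :=
  ∑ k ∈ Finset.range (n + 1), b ^ k / (k.factorial : ℝ) ^ s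

theorem factorial_succ_rpow (s : ℝ) (n : ℕ) :
    ((n + 1).factorial : ℝ) ^ s = ((n : ℝ) + 1) ^ s * (n.factorial : ℝ) ^ s := by
  rw [Nat.factorial_succ]
  push_cast
  rw [Real.mul_rpow (by positivity) (by positivity)]

theorem truncGS_nonneg {s b : ℝ} (hb : 0 ≤ b) (n : ℕ) : 0 ≤ truncGS s b n :=
  Finset.sum_nonneg fun k _ => by positivity

theorem one_le_truncGS {s b : ℝ} (hb : 0 ≤ b) (n : ℕ) : 1 ≤ truncGS s b n := by
  rw [truncGS, Finset.sum_range_succ']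
  have : 0 ≤ ∑ k ∈ Finset.range n, b ^ (k + 1) / ((k + 1).factorial : ℝ) ^ s :=
    Finset.sum_nonneg fun k _ => by positivity
  simpa using this

theorem truncGS_mono {s b : ℝ} (hb : 0 ≤ b) : Monotone (truncGS s b) :=
  monotone_nat_of_le_succ fun n => by
    rw [truncGS, truncGS, Finset.sum_range_succ _ (n + 1)]
    have : 0 ≤ b ^ (n + 1) / ((n + 1).factorial : ℝ) ^ s := by positivity
    linarith

theorem mul_truncGS_le {s b : ℝ} (hs : 0 ≤ s) (hb : 0 ≤ b) (n : ℕ) :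
    b * truncGS s b n ≤ ((n : ℝ) + 1) ^ s * truncGS s b (n + 1) := by
  rw [truncGS, truncGS, Finset.sum_range_succ' _ (n + 1), mul_add, Finset.mul_sum, Finset.mul_sum]
  have h0 : 0 ≤ ((n : ℝ) + 1) ^ s * (b ^ 0 / ((Nat.factorial 0 : ℕ) : ℝ) ^ s) := by positivity
  refine le_trans (Finset.sum_le_sum fun k hk => ?_) (le_add_of_nonneg_right h0)
  have hk' : (k : ℝ) ≤ n := by
    exact_mod_cast Nat.lt_succ_iff.1 (Finset.mem_range.1 hk)
  rw [factorial_succ_rpow]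
  have h1 : 0 < ((k : ℝ) + 1) ^ s := by positivity
  have h2 : 0 < (k.factorial : ℝ) ^ s := by positivity
  have h3 : ((k : ℝ) + 1) ^ s ≤ ((n : ℝ) + 1) ^ s := by gcongr
  have h4 : 0 ≤ b ^ (k + 1) / (((k : ℝ) + 1) ^ s * (k.factorial : ℝ) ^ s) := by positivity
  calc b * (b ^ k / (k.factorial : ℝ) ^ s)
      = ((k : ℝ) + 1) ^ s * (b ^ (k + 1) / (((k : ℝ) + 1) ^ s * (k.factorial : ℝ) ^ s)) := by
        field_simp
        ring
    _ ≤ _ := by gcongr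

theorem pow_le_factorial_rpow_mul_exp {s b : ℝ} (hs : 0 < s) (hb : 0 ≤ b) (k : ℕ) :
    b ^ k ≤ (k.factorial : ℝ) ^ s * Real.exp (s * b ^ (1 / s)) := by
  have hy : 0 ≤ b ^ (1 / s) := by positivity
  have h1 := Real.pow_div_factorial_le_exp _ hy k
  have hk : (0 : ℝ) < k.factorial := by positivity
  rw [div_le_iff₀ hk] at h1
  have h2 := Real.rpow_le_rpow (by positivity) h1 hs.le
  rw [Real.mul_rpow (by positivity) (by positivity), ← Real.exp_mul, ← Real.rpow_natCast,
    ← Real.rpow_mul hb, ← Real.rpow_mul hb] at h2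
  rw [show 1 / s * (k : ℝ) * s = (k : ℝ) by field_simp, Real.rpow_natCast] at h2
  rw [mul_comm s, mul_comm (_ ^ s)]
  exact h2

theorem truncGS_le_exp {s b : ℝ} (hs : 0 < s) (hb : 0 ≤ b) (n : ℕ) :
    truncGS s b n ≤ 2 * Real.exp (s * (2 * b) ^ (1 / s)) := by
  calc truncGS s b n
      ≤ ∑ k ∈ Finset.range (n + 1), (1 / (2 : ℝ)) ^ k * Real.exp (s * (2 * b) ^ (1 / s)) := by
        refine Finset.sum_le_sum fun k _ => ?_
        have h := pow_le_factorial_rpow_mul_exp hs (by positivity : 0 ≤ 2 * b) k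
        rw [div_le_iff₀ (by positivity)]
        rw [mul_pow] at h
        rw [div_pow, one_pow]
        field_simp
        linarith
    _ ≤ _ := by
        rw [← Finset.sum_mul]
        gcongr
        exact sum_geometric_two_le _

theorem natCast_mul_le_rpow_mul_rpow {s M δ : ℝ} {R : ℕ} (hs : 1 / 2 < s) (hM : 0 ≤ M)
    (hR0 : 0 < R) (hR : M ≤ 3 * δ ^ 2 * (R : ℝ) ^ (2 * s - 1)) (n m : ℕ) :
    n * M ≤ 3 * δ ^ 2 * (((n + m + R : ℕ) : ℝ) ^ s * (((n + m + R : ℕ) : ℝ) + 1) ^ s) := by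
  set y : ℝ := ((n + m + R : ℕ) : ℝ) with hy
  have hR0' : (0 : ℝ) < R := by exact_mod_cast hR0
  have hyn : (n : ℝ) ≤ y := by rw [hy]; exact_mod_cast (by omega : n ≤ n + m + R)
  have hyR : (R : ℝ) ≤ y := by rw [hy]; exact_mod_cast (by omega : R ≤ n + m + R)
  have hy0 : 0 < y := hR0'.trans_le hyR
  calc n * M ≤ y * (3 * δ ^ 2 * y ^ (2 * s - 1)) := by
        refine mul_le_mul hyn (hR.trans ?_) hM hy0.le
        have : (R : ℝ) ^ (2 * s - 1) ≤ y ^ (2 * s - 1) :=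
          Real.rpow_le_rpow hR0'.le hyR (by linarith)
        gcongr
    _ = 3 * δ ^ 2 * (y ^ s * y ^ s) := by
        rw [← Real.rpow_add hy0, show s + s = 1 + (2 * s - 1) by ring, Real.rpow_add hy0,
          Real.rpow_one]
        ring
    _ ≤ _ := by
        have : y ^ s ≤ (y + 1) ^ s := Real.rpow_le_rpow hy0.le (by linarith) (by linarith)
        gcongr

/-- Leibniz estimate for the product of a linear function and a smooth function. -/
theorem norm_wordDeriv_clm_mul_le {d : ℕ} (ℓ : Ed d →L[ℝ] ℂ) {M V : ℝ} (hM : ‖ℓ‖ ≤ M)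
    (x : Ed d) (L : List (Fin d)) {v : Ed d → ℂ} (hv : ContDiff ℝ ((⊤ : ℕ∞) : WithTop ℕ∞) v)
    (hV : ∀ L' : List (Fin d), L'.length + 1 = L.length → ‖wordDeriv L' v x‖ ≤ V) :
    ‖wordDeriv L ((fun y => ℓ y) * v) x‖ ≤ M * ‖x‖ * ‖wordDeriv L v x‖ + L.length * (M * V) := by
  have hM0 : 0 ≤ M := (norm_nonneg ℓ).trans hM
  induction L generalizing v with
  | nil =>
    simp only [wordDeriv, Pi.mul_apply, norm_mul, List.length_nil, Nat.cast_zero, zero_mul,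
      add_zero]
    gcongr
    exact ℓ.le_of_opNorm_le hM x
  | cons i L ih =>
    have h1 : pdGS i ((fun y => ℓ y) * v)
        = (fun _ => ℓ (EuclideanSpace.single i 1)) * v + (fun y => ℓ y) * pdGS i v := by
      rw [pdGS_mul ℓ.contDiff hv]
      congr 2
      funext y
      simp [pdGS]
    have hc : ContDiff ℝ ((⊤ : ℕ∞) : WithTop ℕ∞)
        ((fun _ => ℓ (EuclideanSpace.single i 1)) * v) := contDiff_const.mul hv
    have hℓv : ContDiff ℝ ((⊤ : ℕ∞) : WithTop ℕ∞) ((fun y => ℓ y) * pdGS i v) :=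
      ℓ.contDiff.mul (hv.pdGS i)
    have h2 := ih (hv.pdGS i) fun L' hL' => hV (i :: L') (by simp [hL'])
    have h3 : ‖ℓ (EuclideanSpace.single i 1)‖ ≤ M := by
      simpa using ℓ.le_of_opNorm_le hM (EuclideanSpace.single i 1)
    have h4 := hV L (by simp)
    simp only [wordDeriv]
    rw [h1, wordDeriv_add L hc hℓv, wordDeriv_const_mul L _ hv]
    refine (norm_add_le _ _).trans ?_
    simp only [Pi.mul_apply, norm_mul, List.length_cons]
    push_cast
    have h5 : ‖ℓ (EuclideanSpace.single i 1)‖ * ‖wordDeriv L v x‖ ≤ M * V := by gcongr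
    linarith

/-- Pointwise Gelfand–Shilov type estimate for the product of a smooth function with a unimodular
function whose partial derivatives are linear multiples of itself. -/
theorem norm_wordDeriv_mul_le {d : ℕ} {g : Ed d → ℂ} {ℓ : Fin d → (Ed d →L[ℝ] ℂ)}
    {s M δ N : ℝ} {R : ℕ} (hg : ContDiff ℝ ((⊤ : ℕ∞) : WithTop ℕ∞) g)
    (hgℓ : ∀ i, pdGS i g = (fun x => ℓ i x) * g) (hg1 : ∀ x, ‖g x‖ ≤ 1)
    (hs : 1 / 2 < s) (hℓ : ∀ i, ‖ℓ i‖ ≤ M) (hM : 0 ≤ M) (hδ : 0 < δ) (hN : 0 ≤ N) (hR0 : 0 < R)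
    (hR : M ≤ 3 * δ ^ 2 * (R : ℝ) ^ (2 * s - 1)) (x : Ed d) (n : ℕ) :
    ∀ (L : List (Fin d)) (m : ℕ) (u : Ed d → ℂ), L.length = n →
      ContDiff ℝ ((⊤ : ℕ∞) : WithTop ℕ∞) u →
      (∀ L' : List (Fin d), ‖wordDeriv L' u x‖
        ≤ N * δ ^ (m + L'.length) * ((m + L'.length).factorial : ℝ) ^ s) →
      ‖wordDeriv L (g * u) x‖ ≤ N * (3 * δ) ^ n * δ ^ m * ((n + m + R).factorial : ℝ) ^ s
        * truncGS s (M * ‖x‖ / δ) n := by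
  have hs0 : 0 ≤ s := by linarith
  set b : ℝ := M * ‖x‖ / δ with hb_def
  have hb : 0 ≤ b := by positivity
  induction n using Nat.strong_induction_on with
  | _ n ih =>
  intro L m u hL hu hbd
  match L, hL with
  | [], hL =>
    obtain rfl : n = 0 := by simpa using hL.symm
    have h1 := hbd []
    simp only [wordDeriv, List.length_nil, add_zero] at h1
    simp only [wordDeriv, Pi.mul_apply, norm_mul, pow_zero, mul_one]
    have h2 : (m.factorial : ℝ) ^ s ≤ ((0 + m + R).factorial : ℝ) ^ s := by
      have : (m.factorial : ℝ) ≤ ((0 + m + R).factorial : ℝ) := by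
        exact_mod_cast Nat.factorial_le (by omega)
      gcongr
    have h3 := one_le_truncGS (s := s) hb 0
    calc ‖g x‖ * ‖u x‖ ≤ 1 * (N * δ ^ m * (m.factorial : ℝ) ^ s) := by
          gcongr
          exact hg1 x
      _ ≤ N * δ ^ m * ((0 + m + R).factorial : ℝ) ^ s * 1 := by
          rw [one_mul, mul_one]
          gcongr
      _ ≤ _ := by gcongr
  | i :: L, hL =>
    obtain ⟨n, rfl⟩ : ∃ k, n = k + 1 := ⟨L.length, by simpa using hL.symm⟩
    have hL' : L.length = n := by simpa using hL
    have hgu : ContDiff ℝ ((⊤ : ℕ∞) : WithTop ℕ∞) (g * u) := hg.mul hu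
    have hsplit : wordDeriv (i :: L) (g * u) x
        = wordDeriv L ((fun y => ℓ i y) * (g * u)) x + wordDeriv L (g * pdGS i u) x := by
      have h1 : ContDiff ℝ ((⊤ : ℕ∞) : WithTop ℕ∞) ((fun y => ℓ i y) * (g * u)) :=
        (ℓ i).contDiff.mul hgu
      have h2 : ContDiff ℝ ((⊤ : ℕ∞) : WithTop ℕ∞) (g * pdGS i u) := hg.mul (hu.pdGS i)
      simp only [wordDeriv]
      rw [pdGS_mul hg hu, hgℓ, mul_assoc, wordDeriv_add L h1 h2]
      rfl
    set P : ℝ := ((n + m + R).factorial : ℝ) ^ s with hP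
    set Y : ℝ := (((n + m + R : ℕ) : ℝ) + 1) ^ s with hY
    have hfac : ((n + 1 + m + R).factorial : ℝ) ^ s = Y * P := by
      rw [show n + 1 + m + R = n + m + R + 1 by ring, factorial_succ_rpow]
    have hP0 : 0 ≤ P := by positivity
    have hY0 : 0 ≤ Y := by positivity
    set T : ℝ := truncGS s b (n + 1) with hT
    have hT0 : 0 ≤ T := truncGS_nonneg hb _
    have hTn : truncGS s b n ≤ T := truncGS_mono hb n.le_succ
    have hbT : b * truncGS s b n ≤ Y * T := by
      refine (mul_truncGS_le hs0 hb n).trans ?_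
      have : ((n : ℝ) + 1) ^ s ≤ Y := by
        refine Real.rpow_le_rpow (by positivity) ?_ hs0
        push_cast
        have : (0 : ℝ) ≤ m + R := by positivity
        linarith
      gcongr
    set Q : ℝ := N * (3 * δ) ^ n * δ ^ m * δ * (Y * P) * T with hQ
    have hA : ‖wordDeriv L (g * pdGS i u) x‖ ≤ Q := by
      have h := ih n n.lt_succ_self L (m + 1) (pdGS i u) hL' (hu.pdGS i) fun L' => by
        have := hbd (i :: L')
        simp only [List.length_cons] at this
        rw [show m + 1 + L'.length = m + (L'.length + 1) by ring]
        exact this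
      rw [show n + (m + 1) + R = n + 1 + m + R by ring, hfac] at h
      calc _ ≤ _ := h
        _ ≤ N * (3 * δ) ^ n * δ ^ (m + 1) * (Y * P) * T := by gcongr
        _ = Q := by rw [hQ]; ring
    have hB : M * ‖x‖ * ‖wordDeriv L (g * u) x‖ ≤ Q := by
      have h := ih n n.lt_succ_self L m u hL' hu hbd
      calc M * ‖x‖ * ‖wordDeriv L (g * u) x‖
          ≤ M * ‖x‖ * (N * (3 * δ) ^ n * δ ^ m * P * truncGS s b n) := by gcongr
        _ = N * (3 * δ) ^ n * δ ^ m * δ * P * (b * truncGS s b n) := by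
            rw [hb_def]; field_simp
        _ ≤ N * (3 * δ) ^ n * δ ^ m * δ * P * (Y * T) := by gcongr
        _ = Q := by rw [hQ]; ring
    have hC : ∃ V : ℝ, (∀ L' : List (Fin d), L'.length + 1 = L.length →
        ‖wordDeriv L' (g * u) x‖ ≤ V) ∧ L.length * (M * V) ≤ Q := by
      rcases n with _ | k
      · refine ⟨0, fun L' h => by omega, ?_⟩
        rw [hL']
        simp only [Nat.cast_zero, zero_mul]
        positivity
      · refine ⟨N * (3 * δ) ^ k * δ ^ m * ((k + m + R).factorial : ℝ) ^ s * truncGS s b k,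
          fun L' h => ih k (by omega) L' m u (by omega) hu hbd, ?_⟩
        have h1 := natCast_mul_le_rpow_mul_rpow hs hM hR0 hR (k + 1) m
        rw [← hY] at h1
        have h2 : P = ((k + 1 + m + R : ℕ) : ℝ) ^ s * ((k + m + R).factorial : ℝ) ^ s := by
          rw [hP, show k + 1 + m + R = k + m + R + 1 by ring, factorial_succ_rpow]
          push_cast
          rfl
        have h3 : truncGS s b k ≤ T := truncGS_mono hb (by omega)
        rw [hL']
        set Z : ℝ := ((k + m + R).factorial : ℝ) ^ s with hZ
        set X : ℝ := ((k + 1 + m + R : ℕ) : ℝ) ^ s with hX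
        have hZ0 : 0 ≤ Z := by positivity
        have hE0 : 0 ≤ truncGS s b k := truncGS_nonneg hb k
        calc ((k + 1 : ℕ) : ℝ) * (M * (N * (3 * δ) ^ k * δ ^ m * Z * truncGS s b k))
            = (((k + 1 : ℕ) : ℝ) * M) * (N * (3 * δ) ^ k * δ ^ m * Z * truncGS s b k) := by ring
          _ ≤ (3 * δ ^ 2 * (X * Y)) * (N * (3 * δ) ^ k * δ ^ m * Z * T) := by gcongr
          _ = Q := by rw [hQ, h2]; ring
    obtain ⟨V, hV, hVQ⟩ := hC
    have hD := norm_wordDeriv_clm_mul_le (ℓ i) (hℓ i) x L hgu hV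
    rw [hsplit, hfac]
    calc _ ≤ _ := norm_add_le _ _
      _ ≤ Q + Q + Q := by linarith
      _ = _ := by rw [hQ]; ring

theorem factorial_add_le (n R : ℕ) :
    (n + R).factorial ≤ 2 ^ (n + R) * (n.factorial * R.factorial) := by
  rw [← Nat.add_choose_mul_factorial_mul_factorial n R, mul_assoc]
  exact Nat.mul_le_mul_right _ (Nat.choose_le_two_pow _ _)

theorem factorial_mlen_rpow_le {d : ℕ} {s : ℝ} (hs : 0 ≤ s) (β : Fin d → ℕ) :
    ((mlen β).factorial : ℝ) ^ s ≤ (((d : ℝ) + 1) ^ s) ^ mlen β * (mfact β : ℝ) ^ s := by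
  have h : ((mlen β).factorial : ℝ) ≤ ((d : ℝ) + 1) ^ mlen β * mfact β := by
    have h1 : ((mlen β).factorial : ℝ) ≤ (d : ℝ) ^ mlen β * mfact β := by
      exact_mod_cast factorial_mlen_le β
    refine h1.trans ?_
    gcongr
    linarith
  calc _ ≤ (((d : ℝ) + 1) ^ mlen β * mfact β) ^ s := Real.rpow_le_rpow (by positivity) h hs
    _ = _ := by rw [Real.mul_rpow (by positivity) (by positivity), Real.rpow_pow_comm (by positivity)]

theorem factorial_mlen_add_rpow_le {d : ℕ} {s : ℝ} (hs : 0 ≤ s) (β : Fin d → ℕ) (R : ℕ) :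
    ((mlen β + R).factorial : ℝ) ^ s
      ≤ ((2 * ((d : ℝ) + 1)) ^ s) ^ mlen β * ((2 : ℝ) ^ R * R.factorial) ^ s
        * (mfact β : ℝ) ^ s := by
  have h1 : ((mlen β + R).factorial : ℝ)
      ≤ 2 ^ mlen β * (mlen β).factorial * (2 ^ R * R.factorial) := by
    have h : ((mlen β + R).factorial : ℝ)
        ≤ 2 ^ (mlen β + R) * ((mlen β).factorial * R.factorial) := by
      exact_mod_cast factorial_add_le (mlen β) R
    refine h.trans (le_of_eq ?_)
    ring
  calc ((mlen β + R).factorial : ℝ) ^ s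
      ≤ (2 ^ mlen β * (mlen β).factorial * (2 ^ R * R.factorial)) ^ s :=
        Real.rpow_le_rpow (by positivity) h1 hs
    _ = ((2 : ℝ) ^ s) ^ mlen β * ((mlen β).factorial : ℝ) ^ s
          * ((2 : ℝ) ^ R * R.factorial) ^ s := by
        rw [Real.mul_rpow (by positivity) (by positivity),
          Real.mul_rpow (by positivity) (by positivity), Real.rpow_pow_comm (by positivity)]
    _ ≤ ((2 : ℝ) ^ s) ^ mlen β * ((((d : ℝ) + 1) ^ s) ^ mlen β * (mfact β : ℝ) ^ s)
          * ((2 : ℝ) ^ R * R.factorial) ^ s := by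
        gcongr
        exact factorial_mlen_rpow_le hs β
    _ = _ := by
        rw [Real.mul_rpow (by positivity : (0 : ℝ) ≤ 2) (by positivity : (0 : ℝ) ≤ (d : ℝ) + 1),
          mul_pow]
        ring

theorem exists_bound_mul {d : ℕ} {g : Ed d → ℂ} {ℓ : Fin d → (Ed d →L[ℝ] ℂ)} {s : ℝ}
    (hg : ContDiff ℝ ((⊤ : ℕ∞) : WithTop ℕ∞) g)
    (hgℓ : ∀ i, pdGS i g = (fun x => ℓ i x) * g) (hg1 : ∀ x, ‖g x‖ ≤ 1)
    (hs : 1 / 2 < s) {A : ℝ} (hA : 0 < A) :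
    ∃ A' C : ℝ, 0 < A' ∧ 0 < C ∧ ∀ (f : Ed d → ℂ) (N : ℝ), 0 ≤ N →
      ContDiff ℝ ((⊤ : ℕ∞) : WithTop ℕ∞) f →
      (∀ x β, A' ^ mlen β * Real.exp (A' * ‖x‖ ^ (1 / s)) * ‖mderiv β f x‖
        ≤ N * (mfact β : ℝ) ^ s) →
      ∀ x β, A ^ mlen β * Real.exp (A * ‖x‖ ^ (1 / s)) * ‖mderiv β (g * f) x‖
        ≤ C * N * (mfact β : ℝ) ^ s := by
  have hs0 : 0 < s := by linarith
  set K : ℝ := (2 * ((d : ℝ) + 1)) ^ s with hK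
  have hK0 : 0 < K := by positivity
  set δ : ℝ := 1 / (3 * A * K) with hδ_def
  have hδ : 0 < δ := by positivity
  set M : ℝ := ∑ i, ‖ℓ i‖ with hM_def
  have hM : 0 ≤ M := by positivity
  have hℓ : ∀ i, ‖ℓ i‖ ≤ M := fun i =>
    Finset.single_le_sum (f := fun i => ‖ℓ i‖) (fun _ _ => norm_nonneg _) (Finset.mem_univ i)
  obtain ⟨R, hR0, hR⟩ : ∃ R : ℕ, 0 < R ∧ M ≤ 3 * δ ^ 2 * (R : ℝ) ^ (2 * s - 1) := by
    have ht := ((tendsto_rpow_atTop (by linarith : 0 < 2 * s - 1)).comp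
      tendsto_natCast_atTop_atTop).const_mul_atTop (by positivity : 0 < 3 * δ ^ 2)
    exact ((eventually_gt_atTop 0).and (ht.eventually_ge_atTop M)).exists
  set A₂ : ℝ := s * (2 * M / δ) ^ (1 / s) with hA₂
  have hA₂0 : 0 ≤ A₂ := by positivity
  set c : ℝ := ((2 : ℝ) ^ R * R.factorial) ^ s with hc
  have hc0 : 0 < c := by positivity
  refine ⟨1 / δ + A + A₂, 2 * c, by positivity, by positivity, fun f N hN hf hbd x β => ?_⟩
  set A' : ℝ := 1 / δ + A + A₂ with hA'
  have hδA' : 1 ≤ δ * A' := by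
    have : δ * A' = 1 + δ * A + δ * A₂ := by rw [hA']; field_simp
    have h1 : 0 ≤ δ * A := by positivity
    have h2 : 0 ≤ δ * A₂ := by positivity
    linarith
  set t : ℝ := ‖x‖ ^ (1 / s) with ht
  have ht0 : 0 ≤ t := by positivity
  set n := mlen β with hn
  have hword : ∀ L' : List (Fin d), ‖wordDeriv L' f x‖
      ≤ N * Real.exp (-(A' * t)) * δ ^ (0 + L'.length) * ((0 + L'.length).factorial : ℝ) ^ s := by
    intro L'
    obtain ⟨γ, hγ, hγf⟩ := exists_mderiv_eq_wordDeriv L'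
    rw [zero_add, hγf f hf, ← hγ]
    have h1 := hbd x γ
    have h2 : (mfact γ : ℝ) ^ s ≤ ((mlen γ).factorial : ℝ) ^ s := by
      have : (mfact γ : ℝ) ≤ (mlen γ).factorial := by exact_mod_cast mfact_le_factorial_mlen γ
      gcongr
    calc ‖mderiv γ f x‖ ≤ (δ * A') ^ mlen γ * ‖mderiv γ f x‖ :=
          le_mul_of_one_le_left (norm_nonneg _) (one_le_pow₀ hδA')
      _ = Real.exp (-(A' * t)) * δ ^ mlen γ
            * (A' ^ mlen γ * Real.exp (A' * t) * ‖mderiv γ f x‖) := by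
          rw [Real.exp_neg, mul_pow]
          field_simp
      _ ≤ Real.exp (-(A' * t)) * δ ^ mlen γ * (N * ((mlen γ).factorial : ℝ) ^ s) := by
          have h3 := h1.trans (mul_le_mul_of_nonneg_left h2 hN)
          exact mul_le_mul_of_nonneg_left h3 (by positivity)
      _ = _ := by ring
  have hmain := norm_wordDeriv_mul_le hg hgℓ hg1 hs hℓ hM hδ (by positivity) hR0 hR x n
    (wordOf β) 0 f (length_wordOf β) hf hword
  rw [← mderiv_eq_wordDeriv, pow_zero, mul_one, add_zero] at hmain
  have hE : truncGS s (M * ‖x‖ / δ) n ≤ 2 * Real.exp (A₂ * t) := by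
    refine (truncGS_le_exp hs0 (by positivity) n).trans (le_of_eq ?_)
    rw [hA₂, ht, show 2 * (M * ‖x‖ / δ) = 2 * M / δ * ‖x‖ by ring,
      Real.mul_rpow (by positivity) (by positivity), mul_assoc]
  have hE0 : 0 ≤ truncGS s (M * ‖x‖ / δ) n := truncGS_nonneg (by positivity) n
  have hF := factorial_mlen_add_rpow_le hs0.le β R
  rw [← hK, ← hc, ← hn] at hF
  have hone : A * (3 * δ) * K = 1 := by rw [hδ_def]; field_simp
  have hexp : Real.exp (A * t) * Real.exp (-(A' * t)) * Real.exp (A₂ * t) ≤ 1 := by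
    rw [← Real.exp_add, ← Real.exp_add, Real.exp_le_one_iff, hA']
    have : 0 ≤ 1 / δ * t := by positivity
    linarith
  calc A ^ n * Real.exp (A * t) * ‖mderiv β (g * f) x‖
      ≤ A ^ n * Real.exp (A * t) * (N * Real.exp (-(A' * t)) * (3 * δ) ^ n
          * (K ^ n * c * (mfact β : ℝ) ^ s) * (2 * Real.exp (A₂ * t))) := by
        gcongr
        exact hmain.trans (by gcongr)
    _ = (Real.exp (A * t) * Real.exp (-(A' * t)) * Real.exp (A₂ * t)) * (A * (3 * δ) * K) ^ n
          * (2 * c * N * (mfact β : ℝ) ^ s) := by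
        rw [mul_pow (A * (3 * δ)) K, mul_pow A (3 * δ)]
        ring
    _ ≤ 1 * (2 * c * N * (mfact β : ℝ) ^ s) := by
        rw [hone, one_pow, mul_one]
        gcongr
    _ = _ := one_mul _

theorem GSnormA_le_iff {d : ℕ} {s A C : ℝ} {f : Ed d → ℂ} (hC : 0 ≤ C) :
    GSnormA s A f ≤ ENNReal.ofReal C ↔ ∀ x β,
      A ^ mlen β * Real.exp (A * ‖x‖ ^ (1 / s)) * ‖mderiv β f x‖ ≤ C * (mfact β : ℝ) ^ s := by
  simp only [GSnormA, iSup_le_iff]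
  refine forall_congr' fun x => forall_congr' fun β => ?_
  have : (0 : ℝ) < mfact β := by exact_mod_cast mfact_pos β
  rw [ENNReal.ofReal_le_ofReal_iff hC, div_le_iff₀ (by positivity)]

theorem GSnorm_le_iff {d : ℕ} {s h C : ℝ} {f : Ed d → ℂ} (hh : 0 < h) (hC : 0 ≤ C) :
    GSnorm s h f ≤ ENNReal.ofReal C ↔ ∀ x α β, |mpow x α| * ‖mderiv β f x‖
      ≤ C * (h ^ (mlen α + mlen β) * ((mfact α : ℝ) * (mfact β : ℝ)) ^ s) := by
  simp only [GSnorm, iSup_le_iff]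
  refine forall_congr' fun x => forall_congr' fun α => forall_congr' fun β => ?_
  have h1 : (0 : ℝ) < mfact β := by exact_mod_cast mfact_pos β
  have h2 : (0 : ℝ) < mfact α := by exact_mod_cast mfact_pos α
  rw [ENNReal.ofReal_le_ofReal_iff hC, div_le_iff₀ (by positivity)]

theorem abs_mpow_le {d : ℕ} (x : Ed d) (α : Fin d → ℕ) : |mpow x α| ≤ ‖x‖ ^ mlen α := by
  rw [mpow, mlen, Finset.abs_prod, ← Finset.prod_pow_eq_pow_sum]
  refine Finset.prod_le_prod (fun _ _ => abs_nonneg _) fun i _ => ?_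
  rw [abs_pow]
  gcongr
  exact PiLp.norm_apply_le x i

theorem exists_norm_le_mul_abs {d : ℕ} {x : Ed d} (hx : x ≠ 0) :
    ∃ i, ‖x‖ ≤ ((d : ℝ) + 1) * |x i| := by
  by_contra! hcon
  have hx0 : 0 < ‖x‖ := norm_pos_iff.2 hx
  have h1 : ∀ i, x i ^ 2 ≤ (‖x‖ / ((d : ℝ) + 1)) ^ 2 := fun i => by
    rw [← sq_abs]
    gcongr
    rw [le_div_iff₀ (by positivity), mul_comm]
    exact (hcon i).le
  have h2 : ‖x‖ ^ 2 ≤ d * (‖x‖ / ((d : ℝ) + 1)) ^ 2 := by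
    rw [EuclideanSpace.real_norm_sq_eq]
    refine (Finset.sum_le_sum fun i _ => h1 i).trans (le_of_eq ?_)
    simp
  have h3 : (d : ℝ) * (‖x‖ / ((d : ℝ) + 1)) ^ 2 < ‖x‖ ^ 2 := by
    rw [div_pow, ← mul_div_assoc, div_lt_iff₀ (by positivity), mul_comm]
    have : (d : ℝ) < ((d : ℝ) + 1) ^ 2 := by nlinarith [(Nat.cast_nonneg d : (0 : ℝ) ≤ d)]
    gcongr
  exact absurd h2 (not_le.2 h3)

theorem norm_pow_mul_le_of_GSnorm {d : ℕ} {s h C : ℝ} {f : Ed d → ℂ} (hh : 0 < h) (hC : 0 ≤ C)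
    (hf : ∀ x α β, |mpow x α| * ‖mderiv β f x‖
      ≤ C * (h ^ (mlen α + mlen β) * ((mfact α : ℝ) * (mfact β : ℝ)) ^ s))
    (x : Ed d) (k : ℕ) (β : Fin d → ℕ) :
    ‖x‖ ^ k * ‖mderiv β f x‖ ≤ C * (h ^ mlen β * (mfact β : ℝ) ^ s)
      * ((((d : ℝ) + 1) * h) ^ k * (k.factorial : ℝ) ^ s) := by
  by_cases hx : x = 0
  · rcases k with _ | k
    · have h1 := hf x 0 β
      simpa [mpow, mlen, mfact] using h1
    · subst hx
      simp only [norm_zero, ne_eq, Nat.succ_ne_zero, not_false_eq_true, zero_pow, zero_mul]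
      positivity
  · obtain ⟨i, hi⟩ := exists_norm_le_mul_abs hx
    have h1 := hf x (Pi.single i k) β
    have e1 : mpow x (Pi.single i k) = x i ^ k := by
      rw [mpow, Finset.prod_eq_single i] <;> simp +contextual
    have e2 : mlen (Pi.single i k) = k := by simp [mlen]
    have e3 : mfact (Pi.single i k) = k.factorial := by
      rw [mfact, Finset.prod_eq_single i] <;> simp +contextual
    rw [e1, e2, e3, abs_pow, Real.mul_rpow (by positivity) (by positivity), pow_add] at h1
    calc ‖x‖ ^ k * ‖mderiv β f x‖
        ≤ (((d : ℝ) + 1) * |x i|) ^ k * ‖mderiv β f x‖ := by gcongr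
      _ = ((d : ℝ) + 1) ^ k * (|x i| ^ k * ‖mderiv β f x‖) := by rw [mul_pow]; ring
      _ ≤ ((d : ℝ) + 1) ^ k * (C * (h ^ k * h ^ mlen β
            * ((k.factorial : ℝ) ^ s * (mfact β : ℝ) ^ s))) := by gcongr
      _ = _ := by rw [mul_pow]; ring

/-- Exponential decay from factorial bounds on all moments. -/
theorem exp_mul_le_of_pow_mul_le {s A r D Q η : ℝ} (hs : 0 < s) (hA : 0 < A) (hr : 0 ≤ r)
    (hD : 0 ≤ D) (hQ : 0 ≤ Q) (hη : 0 ≤ η) (hηA : η ≤ (s / (2 * A)) ^ s)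
    (h : ∀ k : ℕ, r ^ k * D ≤ Q * (η ^ k * (k.factorial : ℝ) ^ s)) :
    Real.exp (A * r ^ (1 / s)) * D ≤ 2 ^ s * Q := by
  have hη' : A / s * η ^ (1 / s) ≤ 1 / 2 := by
    have h1 : η ^ (1 / s) ≤ s / (2 * A) := by
      calc _ ≤ ((s / (2 * A)) ^ s) ^ (1 / s) := Real.rpow_le_rpow hη hηA (by positivity)
        _ = _ := by
          rw [← Real.rpow_mul (by positivity), mul_one_div_cancel hs.ne', Real.rpow_one]
    calc A / s * η ^ (1 / s) ≤ A / s * (s / (2 * A)) := by gcongr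
      _ = 1 / 2 := by field_simp
  have hk : ∀ k : ℕ, (A / s * r ^ (1 / s)) ^ k / k.factorial * D ^ (1 / s)
      ≤ (1 / 2) ^ k * Q ^ (1 / s) := by
    intro k
    have h1 := Real.rpow_le_rpow (by positivity) (h k) (by positivity : 0 ≤ 1 / s)
    rw [Real.mul_rpow (by positivity) (by positivity), Real.mul_rpow (by positivity) (by positivity),
      Real.mul_rpow (by positivity) (by positivity), ← Real.rpow_mul (by positivity) s,
      mul_one_div_cancel hs.ne', Real.rpow_one, ← Real.rpow_pow_comm hr,
      ← Real.rpow_pow_comm hη] at h1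
    calc (A / s * r ^ (1 / s)) ^ k / k.factorial * D ^ (1 / s)
        = (A / s) ^ k / k.factorial * ((r ^ (1 / s)) ^ k * D ^ (1 / s)) := by
          rw [mul_pow]; ring
      _ ≤ (A / s) ^ k / k.factorial * (Q ^ (1 / s) * ((η ^ (1 / s)) ^ k * k.factorial)) := by
          gcongr
      _ = (A / s * η ^ (1 / s)) ^ k * Q ^ (1 / s) := by
          rw [mul_pow]; field_simp
      _ ≤ _ := by gcongr
  have hsum : Real.exp (A / s * r ^ (1 / s)) * D ^ (1 / s) ≤ 2 * Q ^ (1 / s) := by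
    have h1 : HasSum (fun k : ℕ => (A / s * r ^ (1 / s)) ^ k / k.factorial)
        (Real.exp (A / s * r ^ (1 / s))) := by
      rw [Real.exp_eq_exp_ℝ]
      exact NormedSpace.expSeries_div_hasSum_exp _
    exact hasSum_le hk (h1.mul_right _) (hasSum_geometric_two.mul_right _)
  have h2 := Real.rpow_le_rpow (by positivity) hsum hs.le
  rw [Real.mul_rpow (by positivity) (by positivity), Real.mul_rpow (by positivity) (by positivity),
    ← Real.rpow_mul hD, ← Real.rpow_mul hQ, one_div_mul_cancel hs.ne', Real.rpow_one,
    Real.rpow_one, ← Real.exp_mul] at h2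
  rwa [show A / s * r ^ (1 / s) * s = A * r ^ (1 / s) by field_simp] at h2

theorem GSnormA_lt_top {d : ℕ} {s A : ℝ} {f : Ed d → ℂ} (hs : 0 < s) (hA : 0 < A)
    (hf : ∀ h : ℝ, 0 < h → GSnorm s h f < ⊤) : GSnormA s A f < ⊤ := by
  set h : ℝ := min (1 / A) ((s / (2 * A)) ^ s / ((d : ℝ) + 1)) with hh_def
  have hh : 0 < h := lt_min (by positivity) (by positivity)
  have h1 : A * h ≤ 1 := by
    calc A * h ≤ A * (1 / A) := by gcongr; exact min_le_left _ _
      _ = 1 := by field_simp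
  have h2 : ((d : ℝ) + 1) * h ≤ (s / (2 * A)) ^ s := by
    calc ((d : ℝ) + 1) * h ≤ ((d : ℝ) + 1) * ((s / (2 * A)) ^ s / ((d : ℝ) + 1)) := by
          gcongr; exact min_le_right _ _
      _ = _ := by field_simp
  set C : ℝ := (GSnorm s h f).toReal with hC_def
  have hC : 0 ≤ C := ENNReal.toReal_nonneg
  have hbd := (GSnorm_le_iff hh hC).1 (ENNReal.ofReal_toReal (hf h hh).ne).ge
  refine lt_of_le_of_lt ((GSnormA_le_iff (C := 2 ^ s * C) (by positivity)).2 fun x β => ?_)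
    ENNReal.ofReal_lt_top
  have h3 := exp_mul_le_of_pow_mul_le (Q := C * (h ^ mlen β * (mfact β : ℝ) ^ s)) hs hA
    (norm_nonneg x) (norm_nonneg (mderiv β f x)) (by positivity) (by positivity) h2
    fun k => norm_pow_mul_le_of_GSnorm hh hC hbd x k β
  calc A ^ mlen β * Real.exp (A * ‖x‖ ^ (1 / s)) * ‖mderiv β f x‖
      = A ^ mlen β * (Real.exp (A * ‖x‖ ^ (1 / s)) * ‖mderiv β f x‖) := by ring
    _ ≤ A ^ mlen β * (2 ^ s * (C * (h ^ mlen β * (mfact β : ℝ) ^ s))) := by gcongr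
    _ = (A * h) ^ mlen β * (2 ^ s * C * (mfact β : ℝ) ^ s) := by rw [mul_pow]; ring
    _ ≤ 1 * (2 ^ s * C * (mfact β : ℝ) ^ s) := by
        gcongr
        exact pow_le_one₀ (by positivity) h1
    _ = _ := one_mul _

theorem GSnorm_lt_top {d : ℕ} {s h : ℝ} {f : Ed d → ℂ} (hs : 0 < s) (hh : 0 < h)
    (hf : ∀ A : ℝ, 0 < A → GSnormA s A f < ⊤) : GSnorm s h f < ⊤ := by
  set ρ : ℝ := h / ((d : ℝ) + 1) ^ s with hρ_def
  have hρ : 0 < ρ := by positivity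
  have hρh : ρ * ((d : ℝ) + 1) ^ s = h := by rw [hρ_def]; field_simp
  set A : ℝ := s * (1 / ρ) ^ (1 / s) + 1 / h with hA_def
  have hA : 0 < A := by positivity
  have hAh : 1 ≤ h * A := by
    have h1 : h * A = h * (s * (1 / ρ) ^ (1 / s)) + 1 := by rw [hA_def]; field_simp
    have h2 : 0 ≤ h * (s * (1 / ρ) ^ (1 / s)) := by positivity
    linarith
  set C : ℝ := (GSnormA s A f).toReal with hC_def
  have hC : 0 ≤ C := ENNReal.toReal_nonneg
  have hbd := (GSnormA_le_iff hC).1 (ENNReal.ofReal_toReal (hf A hA).ne).ge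
  refine lt_of_le_of_lt ((GSnorm_le_iff (C := C) hh hC).2 fun x α β => ?_)
    ENNReal.ofReal_lt_top
  set e : ℝ := Real.exp (A * ‖x‖ ^ (1 / s)) with he
  have h1 : (‖x‖ / ρ) ^ mlen α ≤ ((mlen α).factorial : ℝ) ^ s * e := by
    refine (pow_le_factorial_rpow_mul_exp hs (by positivity) _).trans ?_
    gcongr
    rw [show ‖x‖ / ρ = 1 / ρ * ‖x‖ by ring, Real.mul_rpow (by positivity) (by positivity),
      ← mul_assoc, he, hA_def]
    gcongr
    have : 0 ≤ 1 / h := by positivity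
    linarith
  have h2 : |mpow x α| ≤ h ^ mlen α * (mfact α : ℝ) ^ s * e := by
    calc |mpow x α| ≤ ‖x‖ ^ mlen α := abs_mpow_le x α
      _ = ρ ^ mlen α * (‖x‖ / ρ) ^ mlen α := by rw [← mul_pow]; field_simp
      _ ≤ ρ ^ mlen α * ((((d : ℝ) + 1) ^ s) ^ mlen α * (mfact α : ℝ) ^ s * e) := by
          gcongr
          exact h1.trans (by gcongr; exact factorial_mlen_rpow_le hs.le α)
      _ = (ρ * ((d : ℝ) + 1) ^ s) ^ mlen α * (mfact α : ℝ) ^ s * e := by rw [mul_pow]; ring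
      _ = _ := by rw [hρh]
  calc |mpow x α| * ‖mderiv β f x‖
      ≤ h ^ mlen α * (mfact α : ℝ) ^ s * e * ((h * A) ^ mlen β * ‖mderiv β f x‖) := by
        gcongr
        exact le_mul_of_one_le_left (norm_nonneg _) (one_le_pow₀ hAh)
    _ = h ^ mlen α * (mfact α : ℝ) ^ s * h ^ mlen β
          * (A ^ mlen β * e * ‖mderiv β f x‖) := by rw [mul_pow]; ring
    _ ≤ h ^ mlen α * (mfact α : ℝ) ^ s * h ^ mlen β * (C * (mfact β : ℝ) ^ s) := by
        exact mul_le_mul_of_nonneg_left (hbd x β) (by positivity)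
    _ = _ := by
        rw [Real.mul_rpow (by positivity) (by positivity), pow_add]
        ring

/-- The linear function `x ↦ i (Bx)_k`. -/
def chirpCLM {d : ℕ} (B : Matrix (Fin d) (Fin d) ℝ) (k : Fin d) : Ed d →L[ℝ] ℂ :=
  ∑ j, (Complex.I * (B k j : ℂ)) • (Complex.ofRealCLM ∘L EuclideanSpace.proj j)

theorem chirpCLM_apply {d : ℕ} (B : Matrix (Fin d) (Fin d) ℝ) (k : Fin d) (x : Ed d) :
    chirpCLM B k x = Complex.I * ((∑ j, B k j * x j : ℝ) : ℂ) := by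
  simp [chirpCLM, Finset.mul_sum, mul_assoc]

theorem contDiff_chirp {d : ℕ} (B : Matrix (Fin d) (Fin d) ℝ) :
    ContDiff ℝ ((⊤ : ℕ∞) : WithTop ℕ∞)
      (fun x : Ed d => Complex.exp (Complex.I * ((qf B x : ℝ) : ℂ) / 2)) := by
  have h : ContDiff ℝ ((⊤ : ℕ∞) : WithTop ℕ∞) (fun x : Ed d => qf B x) := by
    unfold qf
    fun_prop
  have h2 : ContDiff ℝ ((⊤ : ℕ∞) : WithTop ℕ∞) (fun x : Ed d => ((qf B x : ℝ) : ℂ)) :=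
    Complex.ofRealCLM.contDiff.comp h
  exact ((contDiff_const.mul h2).div_const 2).cexp

theorem qf_add_smul_single {d : ℕ} {B : Matrix (Fin d) (Fin d) ℝ} (hB : B.IsSymm) (x : Ed d)
    (k : Fin d) (t : ℝ) : qf B (x + t • EuclideanSpace.single k 1)
      = qf B x + t * (2 * ∑ j, B k j * x j) + t ^ 2 * B k k := by
  have h1 : ∀ i, (∑ j, B i j * (x + t • EuclideanSpace.single k (1 : ℝ)) j)
      = (∑ j, B i j * x j) + t * B i k := by
    intro i
    simp [mul_add, Finset.sum_add_distrib, Finset.sum_ite_eq', mul_comm]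
  have h2 : ∑ i, B i k * x i = ∑ j, B k j * x j :=
    Finset.sum_congr rfl fun i _ => by rw [hB.apply]
  simp only [qf, h1]
  rw [← h2]
  simp only [PiLp.add_apply, PiLp.smul_apply, smul_eq_mul, mul_add, add_mul,
    Finset.sum_add_distrib, PiLp.single_apply, mul_ite, mul_one, mul_zero, Finset.sum_ite_eq',
    Finset.mem_univ, if_true]
  have h3 : ∑ j, B k j * x j = ∑ i, B i k * x i := h2.symm
  have h4 : ∑ i, t * B i k * x i = t * ∑ i, B i k * x i := by
    simp only [Finset.mul_sum, mul_assoc]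
  rw [h3, h4]
  ring

theorem pdGS_chirp {d : ℕ} {B : Matrix (Fin d) (Fin d) ℝ} (hB : B.IsSymm) (k : Fin d) :
    pdGS k (fun x : Ed d => Complex.exp (Complex.I * ((qf B x : ℝ) : ℂ) / 2))
      = (fun x => chirpCLM B k x)
        * fun x : Ed d => Complex.exp (Complex.I * ((qf B x : ℝ) : ℂ) / 2) := by
  funext x
  have hd := (contDiff_chirp B).differentiable (by simp) x
  rw [pdGS, ← hd.lineDeriv_eq_fderiv, lineDeriv]
  simp only [qf_add_smul_single hB, Pi.mul_apply, chirpCLM_apply]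
  set p : ℝ := ∑ j, B k j * x j
  have h1 : HasDerivAt (fun t : ℝ => qf B x + t * (2 * p) + t ^ 2 * B k k) (2 * p) 0 := by
    have := (((hasDerivAt_id (0 : ℝ)).mul_const (2 * p)).const_add (qf B x)).add
      ((hasDerivAt_pow 2 (0 : ℝ)).mul_const (B k k))
    refine this.congr_deriv ?_
    simp
  have h2 := ((h1.ofReal_comp.const_mul Complex.I).div_const 2).cexp
  rw [h2.deriv]
  simp
  ring

theorem norm_chirp {d : ℕ} (B : Matrix (Fin d) (Fin d) ℝ) (x : Ed d) :
    ‖Complex.exp (Complex.I * ((qf B x : ℝ) : ℂ) / 2)‖ = 1 := by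
  rw [show Complex.I * ((qf B x : ℝ) : ℂ) / 2 = ((qf B x / 2 : ℝ) : ℂ) * Complex.I by
    push_cast; ring]
  exact Complex.norm_exp_ofReal_mul_I _

theorem statement11 (d : ℕ) (s : ℝ) (hs : 1/2 < s)
    (B : Matrix (Fin d) (Fin d) ℝ) (hB : B.IsSymm) :
    (∀ f ∈ SigmaGS s d,
      (fun x : Ed d => Complex.exp (Complex.I * ((qf B x : ℝ) : ℂ) / 2) * f x) ∈ SigmaGS s d) ∧
    ∀ A : ℝ, 0 < A → ∃ A' C : ℝ, 0 < A' ∧ 0 < C ∧ ∀ f ∈ SigmaGS s d,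
      GSnormA s A (fun x : Ed d => Complex.exp (Complex.I * ((qf B x : ℝ) : ℂ) / 2) * f x)
        ≤ ENNReal.ofReal C * GSnormA s A' f := by
  have hs0 : 0 < s := by linarith
  have hbound : ∀ A : ℝ, 0 < A → ∃ A' C : ℝ, 0 < A' ∧ 0 < C ∧ ∀ f ∈ SigmaGS s d,
      GSnormA s A (fun x : Ed d => Complex.exp (Complex.I * ((qf B x : ℝ) : ℂ) / 2) * f x)
        ≤ ENNReal.ofReal C * GSnormA s A' f := by
    intro A hA
    obtain ⟨A', C, hA', hC, h⟩ := exists_bound_mul (contDiff_chirp B) (pdGS_chirp hB)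
      (fun x => (norm_chirp B x).le) hs hA
    refine ⟨A', C, hA', hC, fun f hf => ?_⟩
    have hN : 0 ≤ (GSnormA s A' f).toReal := ENNReal.toReal_nonneg
    have hfin := ENNReal.ofReal_toReal (GSnormA_lt_top hs0 hA' hf.2).ne
    rw [← hfin, ← ENNReal.ofReal_mul hC.le]
    exact (GSnormA_le_iff (by positivity)).2
      (h f _ hN hf.1 ((GSnormA_le_iff hN).1 hfin.ge))
  refine ⟨fun f hf => ⟨(contDiff_chirp B).mul hf.1, fun h hh => GSnorm_lt_top hs0 hh
    fun A hA => ?_⟩, hbound⟩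
  obtain ⟨A', C, hA', hC, h⟩ := hbound A hA
  exact (h f hf).trans_lt
    (ENNReal.mul_lt_top ENNReal.ofReal_lt_top (GSnormA_lt_top hs0 hA' hf.2))

end
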